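/- Let E be a complex normed vector space and let ψ : E → ℝ be twice (real) Fréchet differentiable at p ∈ E, with ψ(x) ≥ 0 for all x ∈ E and ψ(p) > 0. Assume the Levi form of ψ is positive semidefinite at p. Then for every v ∈ E one has L_{ψ²}(p,v) = 0 if and only if L_ψ(p,v) = 0 and Dψ(p)(v) = 0 and Dψ(p)(i·v) = 0. In other words, the kernel of the Levi form of ψ² at p is the intersection of the kernel of the Levi form of ψ at p with the kernel of dψ(p) (as a complex-linear condition). -/

import Mathlib

open Complex Filter

/-- The Levi form (up to a positive constant) of a function `f : E → ℝ` at `p` in the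
direction `v`: `L_f(p,v) = D²f(p)(v,v) + D²f(p)(i·v, i·v)`, where the second derivative is
the second real Fréchet derivative `fderiv ℝ (fderiv ℝ f) p`. -/
noncomputable def leviForm {E : Type*} [NormedAddCommGroup E] [NormedSpace ℂ E]
    (f : E → ℝ) (p v : E) : ℝ :=
  fderiv ℝ (fderiv ℝ f) p v v + fderiv ℝ (fderiv ℝ f) p (Complex.I • v) (Complex.I • v)

/-- The second derivative of `f ^ 2`: `D²(f²)(v,w) = 2 f D²f(v,w) + 2 Df(v) Df(w)`. -/
theorem fderiv_fderiv_sq_apply {E : Type*} [NormedAddCommGroup E] [NormedSpace ℝ E]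
    {f : E → ℝ} {p : E} (h1 : ∀ᶠ x in nhds p, DifferentiableAt ℝ f x)
    (h2 : DifferentiableAt ℝ (fderiv ℝ f) p) (v w : E) :
    fderiv ℝ (fderiv ℝ fun x => f x ^ 2) p v w =
      2 * f p * fderiv ℝ (fderiv ℝ f) p v w + 2 * fderiv ℝ f p v * fderiv ℝ f p w := by
  have hD : fderiv ℝ (fun x => f x ^ 2) =ᶠ[nhds p] fun x => (2 * f x) • fderiv ℝ f x := by
    filter_upwards [h1] with x hx
    simpa using (hx.hasFDerivAt.pow 2).fderiv
  have hD2 := (h1.self_of_nhds.hasFDerivAt.const_mul (2 : ℝ)).smul h2.hasFDerivAt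
  rw [(hD2.congr_of_eventuallyEq hD).fderiv]
  simp

/-- The Levi form of a square: `L_{f²} = 2 f L_f + 2 (Df(v)² + Df(iv)²)`. -/
theorem leviForm_sq {E : Type*} [NormedAddCommGroup E] [NormedSpace ℂ E]
    {f : E → ℝ} {p : E} (h1 : ∀ᶠ x in nhds p, DifferentiableAt ℝ f x)
    (h2 : DifferentiableAt ℝ (fderiv ℝ f) p) (v : E) :
    leviForm (fun x => f x ^ 2) p v =
      2 * f p * leviForm f p v +
        2 * (fderiv ℝ f p v ^ 2 + fderiv ℝ f p (Complex.I • v) ^ 2) := by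
  simp only [leviForm, fderiv_fderiv_sq_apply h1 h2]
  ring

/-- for `ψ ≥ 0` twice real Fréchet differentiable at `p` with `ψ(p) > 0` and
Levi form positive semidefinite at `p`, the kernel of the Levi form of `ψ²` at `p` is the
intersection of the kernel of the Levi form of `ψ` at `p` with the kernel of `dψ(p)`
(as a complex-linear condition). -/
theorem leviForm_sq_kernel {E : Type*} [NormedAddCommGroup E] [NormedSpace ℂ E]
    (ψ : E → ℝ) (p : E)
    (h1 : ∀ᶠ x in nhds p, DifferentiableAt ℝ ψ x)
    (h2 : DifferentiableAt ℝ (fderiv ℝ ψ) p)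
    (hnonneg : ∀ x, 0 ≤ ψ x) (hpos : 0 < ψ p)
    (hpsh : ∀ v : E, 0 ≤ leviForm ψ p v) :
    ∀ v : E,
      leviForm (fun x => ψ x ^ 2) p v = 0 ↔
        leviForm ψ p v = 0 ∧ fderiv ℝ ψ p v = 0 ∧ fderiv ℝ ψ p (Complex.I • v) = 0 := by
  intro v
  rw [leviForm_sq h1 h2]
  constructor
  · intro h
    have hL : 0 ≤ 2 * ψ p * leviForm ψ p v := mul_nonneg (by positivity) (hpsh v)
    have ha := sq_nonneg (fderiv ℝ ψ p v)
    have hb := sq_nonneg (fderiv ℝ ψ p (Complex.I • v))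
    have hL0 : 2 * ψ p * leviForm ψ p v = 0 := by linarith
    exact ⟨(mul_eq_zero.mp hL0).resolve_left (by positivity),
      pow_eq_zero_iff two_ne_zero |>.mp (by linarith),
      pow_eq_zero_iff two_ne_zero |>.mp (by linarith)⟩
  · rintro ⟨hL, ha, hb⟩
    simp [hL, ha, hb]
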